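/- For |q|<1, ∑_{n≥0} q^{2n+1} (-q^{2n+6};q^2)_∞ (-q^{2n+2};q^2)_∞ / ((q^{2n+3};q^2)_∞ (q^{2n+1};q^2)_∞) = 2q (-q^2;q)_∞ (-q^4;q)_∞ / ((q^2;q^4)_∞ (q^6;q^4)_∞) - q/((1+q)(1+q^3)). -/

import Mathlib

open scoped BigOperators

noncomputable def qPoch (a q : ℂ) (n : ℕ) : ℂ := ∏ j ∈ Finset.range n, (1 - a * q ^ j)

noncomputable def qPochInf (a q : ℂ) : ℂ := ∏' j : ℕ, (1 - a * q ^ j)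

lemma aux_summable (a q : ℂ) (hq : ‖q‖ < 1) : Summable (fun j : ℕ => ‖-(a * q ^ j)‖) := by
  simp only [norm_neg, norm_mul, norm_pow]
  exact (summable_geometric_of_lt_one (norm_nonneg _) hq).mul_left _

lemma aux_mult (a q : ℂ) (hq : ‖q‖ < 1) : Multipliable (fun j : ℕ => 1 - a * q ^ j) := by
  simpa only [sub_eq_add_neg] using multipliable_one_add_of_summable (aux_summable a q hq)

lemma one_sub_ne (a : ℂ) (ha : ‖a‖ < 1) : 1 - a ≠ 0 := by
  intro h
  have : a = 1 := by linear_combination -h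
  rw [this] at ha
  simp at ha

lemma aux_ne (a q : ℂ) (ha : ‖a‖ < 1) (hq : ‖q‖ < 1) : qPochInf a q ≠ 0 := by
  unfold qPochInf
  have := tprod_one_add_ne_zero_of_summable (f := fun j : ℕ => -(a * q ^ j)) ?_
    (aux_summable a q hq)
  · simpa only [sub_eq_add_neg] using this
  · intro j
    have := one_sub_ne (a * q ^ j) (by
      rw [norm_mul, norm_pow]
      exact lt_of_le_of_lt (mul_le_of_le_one_right (norm_nonneg _)
        (pow_le_one₀ (norm_nonneg _) hq.le)) ha)
    simpa only [sub_eq_add_neg] using this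

lemma aux_split (a q : ℂ) (hq : ‖q‖ < 1) (n : ℕ) :
    qPoch a q n * qPochInf (a * q ^ n) q = qPochInf a q := by
  unfold qPoch qPochInf
  have e : (fun j : ℕ => 1 - a * q ^ n * q ^ j) = fun j : ℕ => 1 - a * q ^ (j + n) := by
    ext j; ring
  have hm := aux_mult (a * q ^ n) q hq
  rw [e] at hm ⊢
  exact Multipliable.prod_mul_tprod_nat_mul' (f := fun j : ℕ => 1 - a * q ^ j) hm

lemma aux_step (a q : ℂ) (hq : ‖q‖ < 1) :
    qPochInf a q = (1 - a) * qPochInf (a * q) q := by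
  have := aux_split a q hq 1
  simpa [qPoch] using this.symm

lemma aux_lim (a q : ℂ) (ha : ‖a‖ < 1) (hq : ‖q‖ < 1) :
    Filter.Tendsto (fun n : ℕ => qPochInf (a * q ^ n) q) Filter.atTop (nhds 1) := by
  have h0 := aux_ne a q ha hq
  have h1 : Filter.Tendsto (fun n : ℕ => qPoch a q n) Filter.atTop (nhds (qPochInf a q)) :=
    (aux_mult a q hq).tendsto_prod_tprod_nat
  have h2 := (tendsto_const_nhds (x := qPochInf a q)).div h1 h0
  rw [div_self h0] at h2
  refine h2.congr fun n => ?_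
  have h3 := aux_split a q hq n
  have h4 : qPoch a q n ≠ 0 := by
    intro h; rw [h, zero_mul] at h3; exact h0 h3.symm
  simp only [Pi.div_apply]
  rw [← h3]
  field_simp

lemma norm_sq_lt (q : ℂ) (hq : ‖q‖ < 1) : ‖q ^ 2‖ < 1 := by
  rw [norm_pow]; exact pow_lt_one₀ (norm_nonneg _) hq (by norm_num)

lemma aux_evenodd (a q : ℂ) (hq : ‖q‖ < 1) :
    qPochInf a q = qPochInf a (q ^ 2) * qPochInf (a * q) (q ^ 2) := by
  have h1 := aux_mult a (q ^ 2) (norm_sq_lt q hq)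
  have h2 := aux_mult (a * q) (q ^ 2) (norm_sq_lt q hq)
  unfold qPochInf
  have e1 : (fun j : ℕ => 1 - a * (q ^ 2) ^ j) = fun j : ℕ => 1 - a * q ^ (2 * j) := by
    ext j; ring
  have e2 : (fun j : ℕ => 1 - a * q * (q ^ 2) ^ j) = fun j : ℕ => 1 - a * q ^ (2 * j + 1) := by
    ext j; ring
  rw [e1] at h1 ⊢
  rw [e2] at h2 ⊢
  exact (tprod_even_mul_odd (f := fun j : ℕ => 1 - a * q ^ j) h1 h2).symm

lemma aux_sq (a q : ℂ) (hq : ‖q‖ < 1) :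
    qPochInf (a ^ 2) (q ^ 2) = qPochInf a q * qPochInf (-a) q := by
  unfold qPochInf
  rw [← (aux_mult a q hq).tprod_mul (aux_mult (-a) q hq)]
  congr 1
  ext j; ring

theorem stmt_12 (q : ℂ) (hq : ‖q‖ < 1) :
    (∑' n : ℕ, q ^ (2 * n + 1) * qPochInf (-q ^ (2 * n + 6)) (q ^ 2) *
        qPochInf (-q ^ (2 * n + 2)) (q ^ 2) /
        (qPochInf (q ^ (2 * n + 3)) (q ^ 2) * qPochInf (q ^ (2 * n + 1)) (q ^ 2))) =
      2 * q * qPochInf (-q ^ 2) q * qPochInf (-q ^ 4) q /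
        (qPochInf (q ^ 2) (q ^ 4) * qPochInf (q ^ 6) (q ^ 4)) -
        q / ((1 + q) * (1 + q ^ 3)) := by
  have hQ := norm_sq_lt q hq
  have hp : ∀ k : ℕ, ‖q ^ (k + 1)‖ < 1 := fun k => by
    rw [norm_pow]; exact pow_lt_one₀ (norm_nonneg _) hq (by omega)
  have hn : ∀ k : ℕ, ‖-q ^ (k + 1)‖ < 1 := fun k => by rw [norm_neg]; exact hp k
  have hpne : ∀ k : ℕ, qPochInf (q ^ (k + 1)) (q ^ 2) ≠ 0 := fun k => aux_ne _ _ (hp k) hQ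
  have hnne : ∀ k : ℕ, qPochInf (-q ^ (k + 1)) (q ^ 2) ≠ 0 := fun k => aux_ne _ _ (hn k) hQ
  have h1p : ∀ k : ℕ, 1 - q ^ (k + 1) ≠ 0 := fun k => one_sub_ne _ (hp k)
  have h1n : ∀ k : ℕ, 1 + q ^ (k + 1) ≠ 0 := fun k => by
    have := one_sub_ne _ (hn k); rwa [sub_neg_eq_add] at this
  have sp : ∀ k : ℕ, qPochInf (q ^ k) (q ^ 2) = (1 - q ^ k) * qPochInf (q ^ (k + 2)) (q ^ 2) :=
    fun k => by rw [aux_step _ _ hQ, pow_add]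
  have sn : ∀ k : ℕ, qPochInf (-q ^ k) (q ^ 2) = (1 + q ^ k) * qPochInf (-q ^ (k + 2)) (q ^ 2) :=
    fun k => by rw [aux_step _ _ hQ, pow_add, sub_neg_eq_add, neg_mul]
  have lp : ∀ k : ℕ, Filter.Tendsto (fun n : ℕ => qPochInf (q ^ (2 * n + (k + 1))) (q ^ 2))
      Filter.atTop (nhds 1) := fun k => by
    refine (aux_lim _ _ (hp k) hQ).congr fun n => ?_
    congr 1; ring
  have ln : ∀ k : ℕ, Filter.Tendsto (fun n : ℕ => qPochInf (-q ^ (2 * n + (k + 1))) (q ^ 2))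
      Filter.atTop (nhds 1) := fun k => by
    refine (aux_lim _ _ (hn k) hQ).congr fun n => ?_
    congr 1; ring
  set F : ℕ → ℂ := fun n => qPochInf (-q ^ (2 * n + 6)) (q ^ 2) *
        qPochInf (-q ^ (2 * n + 2)) (q ^ 2) /
        (qPochInf (q ^ (2 * n + 3)) (q ^ 2) * qPochInf (q ^ (2 * n + 1)) (q ^ 2)) with hF
  have hF1 : Filter.Tendsto F Filter.atTop (nhds 1) := by
    have := ((ln 5).mul (ln 1)).div ((lp 2).mul (lp 0)) (by norm_num)
    rw [show (1 : ℂ) * 1 / (1 * 1) = 1 by norm_num] at this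
    exact this
  set U : ℕ → ℂ := fun n => (1 + q ^ (2 * n)) * (1 + q ^ (2 * n + 4)) * F n with hU
  have hU1 : Filter.Tendsto U Filter.atTop (nhds 1) := by
    have h0 : Filter.Tendsto (fun n : ℕ => q ^ (2 * n)) Filter.atTop (nhds 0) := by
      simpa only [pow_mul] using tendsto_pow_atTop_nhds_zero_of_norm_lt_one hQ
    have h4 : Filter.Tendsto (fun n : ℕ => q ^ (2 * n + 4)) Filter.atTop (nhds 0) := by
      simpa only [pow_add, zero_mul] using h0.mul_const (q ^ 4)
    have := ((h0.const_add 1).mul (h4.const_add 1)).mul hF1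
    simpa using this
  have hUs : ∀ n, U (n + 1) = (1 - q ^ (2 * n + 1)) * (1 - q ^ (2 * n + 3)) * F n := by
    intro n
    have a1 := sn (2 * n + 6)
    have a2 := sn (2 * n + 2)
    have a3 := sp (2 * n + 3)
    have a4 := sp (2 * n + 1)
    have n1 := hpne (2 * n + 4)
    have n2 := hpne (2 * n + 2)
    have n3 := h1p (2 * n + 2)
    have n4 := h1p (2 * n)
    simp only [hU, hF, show 2 * (n + 1) = 2 * n + 2 by ring, add_assoc, Nat.reduceAdd] at *
    rw [a1, a2, a4, a3]
    field_simp
  have hc : (1 + q) * (1 + q ^ 3) ≠ 0 := by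
    have := h1n 0
    simp only [zero_add, pow_one] at this
    exact mul_ne_zero this (h1n 2)
  have hterm : ∀ n, q ^ (2 * n + 1) * F n =
      q / ((1 + q) * (1 + q ^ 3)) * (U n - U (n + 1)) := by
    intro n
    rw [hUs]
    simp only [hU]
    rw [div_mul_eq_mul_div, eq_div_iff hc]
    ring
  have hsum : HasSum (fun n => q ^ (2 * n + 1) * F n)
      (q / ((1 + q) * (1 + q ^ 3)) * (U 0 - 1)) := by
    have hs : Summable (fun n => ‖q ^ (2 * n + 1) * F n‖) := by
      obtain ⟨C, hC⟩ := hF1.norm.bddAbove_range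
      refine Summable.of_nonneg_of_le (fun _ => norm_nonneg _) (fun n => ?_)
        ((summable_geometric_of_lt_one (norm_nonneg _) hQ).mul_right (‖q‖ * C))
      rw [pow_succ, pow_mul, norm_mul, norm_mul, norm_pow, mul_assoc]
      have : ‖F n‖ ≤ C := hC ⟨n, rfl⟩
      gcongr
    rw [hasSum_iff_tendsto_nat_of_summable_norm hs]
    simp only [hterm, ← Finset.mul_sum, Finset.sum_range_sub']
    exact (hU1.const_sub _).const_mul _
  have hl : ∀ n : ℕ, q ^ (2 * n + 1) * qPochInf (-q ^ (2 * n + 6)) (q ^ 2) *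
        qPochInf (-q ^ (2 * n + 2)) (q ^ 2) /
        (qPochInf (q ^ (2 * n + 3)) (q ^ 2) * qPochInf (q ^ (2 * n + 1)) (q ^ 2)) =
      q ^ (2 * n + 1) * F n := fun n => by simp only [hF]; ring
  simp only [hl]
  rw [hsum.tsum_eq]
  have b1 := aux_evenodd (-q ^ 2) q hq
  have b2 := aux_evenodd (-q ^ 4) q hq
  have b3 := aux_sq q (q ^ 2) hQ
  have b4 := aux_sq (q ^ 3) (q ^ 2) hQ
  rw [show -q ^ 2 * q = -q ^ 3 by ring] at b1
  rw [show -q ^ 4 * q = -q ^ 5 by ring] at b2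
  rw [show (q ^ 2) ^ 2 = q ^ 4 by ring] at b3 b4
  rw [show (q ^ 3) ^ 2 = q ^ 6 by ring] at b4
  have c1 := sn 1
  have c2 := sn 3
  have c3 := sn 4
  have n1 := hpne 0
  have n2 := hpne 2
  have n3 := hnne 4
  have n4 := h1n 0
  have n5 := h1n 2
  simp only [zero_add, pow_one, Nat.reduceAdd] at c1 c2 c3 n1 n2 n3 n4 n5
  rw [b1, b2, b3, b4, c1, c2, c3]
  simp only [hU, hF, mul_zero, zero_add, pow_zero, pow_one]
  field_simp
  ring
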